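/- arXiv:1512.03200 — 2 statements merged into one kernel-verified Lean document; each statement's English description precedes it below -/
import Mathlib

section
/- Let M and A be real symmetric V×V matrices with ker(M) ⊆ ker(A), and suppose that for all β in some interval, corank(βA + M) ≥ corank(M). If λ_m denotes the m-th smallest eigenvalue (with multiplicity) of a symmetric matrix, k = corank(M), and for a sequence β_n → α with λ^-(β_n A + M) ≥ 2 for all n, then λ_{k+2}(αA + M) ≤ 0, i.e., corank(αA + M) ≥ k + 1 or λ^-(αA+M) ≥ 2; in particular, if additionally λ^-(αA+M) ≤ 1 then corank(αA + M) ≥ k + 1. -/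
open Matrix

/-- The number of negative eigenvalues of a real symmetric matrix (0 if not symmetric). -/
noncomputable def negEig {V : Type*} [Fintype V] [DecidableEq V] (X : Matrix V V ℝ) : ℕ :=
  if h : X.IsHermitian then Fintype.card {i // h.eigenvalues i < 0} else 0

/-- The corank (nullity) of a matrix. -/
noncomputable def corank {V : Type*} [Fintype V] [DecidableEq V] (X : Matrix V V ℝ) : ℕ :=
  Module.finrank ℝ (LinearMap.ker X.mulVecLin)

theorem count_eq {V : Type*} [Fintype V] [DecidableEq V] (X : Matrix V V ℝ) (h : X.IsHermitian) :
    negEig X + corank X + Fintype.card {i // 0 < h.eigenvalues i} = Fintype.card V := by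
  have h1 : X.rank + corank X = Fintype.card V := by
    have := LinearMap.finrank_range_add_finrank_ker X.mulVecLin
    rw [Module.finrank_fintype_fun_eq_card] at this
    exact this
  have h2 := h.rank_eq_card_non_zero_eigs
  have h3 : Fintype.card {i // h.eigenvalues i ≠ 0} =
      Fintype.card {i // h.eigenvalues i < 0} + Fintype.card {i // 0 < h.eigenvalues i} := by
    rw [← Fintype.card_subtype_or_disjoint]
    · exact Fintype.card_congr (Equiv.subtypeEquivRight fun i => ne_iff_lt_or_gt)
    · rw [Pi.disjoint_iff]
      intro i
      rw [Prop.disjoint_iff]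
      intro hh
      exact lt_asymm hh.1 hh.2
  simp only [negEig, h, dif_pos]
  omega

theorem quad_eq {V : Type*} [Fintype V] [DecidableEq V] (X : Matrix V V ℝ) (h : X.IsHermitian)
    (x : EuclideanSpace ℝ V) :
    inner ℝ x (Matrix.toEuclideanLin X x) =
      ∑ i, h.eigenvalues i * (inner ℝ (h.eigenvectorBasis i) x) ^ 2 := by
  have hs : (Matrix.toEuclideanLin X).IsSymmetric := Matrix.isSymmetric_toEuclideanLin_iff.2 h
  rw [← h.eigenvectorBasis.sum_inner_mul_inner]
  refine Finset.sum_congr rfl fun i _ => ?_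
  have e : Matrix.toEuclideanLin X (h.eigenvectorBasis i) =
      h.eigenvalues i • h.eigenvectorBasis i := by
    ext j
    have := congrFun (h.mulVec_eigenvectorBasis i) j
    simpa [Matrix.toLpLin_apply] using this
  rw [← hs, e, inner_smul_left, real_inner_comm]
  simp
  ring

theorem pos_semicont {V : Type*} [Fintype V] [DecidableEq V] (X A : Matrix V V ℝ)
    (h : X.IsHermitian) : ∃ ε > 0, ∀ t : ℝ, |t| < ε → ∀ h' : (X + t • A).IsHermitian,
      Fintype.card {i // 0 < h.eigenvalues i} ≤ Fintype.card {i // 0 < h'.eigenvalues i} := by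
  obtain ⟨c, hc, hcpos⟩ : ∃ c : ℝ, (∀ i, 0 < h.eigenvalues i → c ≤ h.eigenvalues i) ∧ 0 < c := by
    have : ∀ᶠ c in nhdsWithin (0:ℝ) (Set.Ioi 0),
        ∀ i, 0 < h.eigenvalues i → c ≤ h.eigenvalues i := by
      rw [Filter.eventually_all]
      intro i
      by_cases hi : 0 < h.eigenvalues i
      · filter_upwards [Ioo_mem_nhdsGT hi] with c hc _ using hc.2.le
      · exact Filter.Eventually.of_forall fun c h => absurd h hi
    exact (this.and self_mem_nhdsWithin).exists
  let T := LinearMap.toContinuousLinearMap (Matrix.toEuclideanLin A)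
  refine ⟨c / (‖T‖ + 1), by positivity, fun t ht h' => ?_⟩
  by_contra! hlt
  let L : EuclideanSpace ℝ V →ₗ[ℝ]
      ({i // ¬ 0 < h.eigenvalues i} → ℝ) × ({i // 0 < h'.eigenvalues i} → ℝ) :=
    LinearMap.prod (LinearMap.pi fun i => innerₛₗ ℝ (h.eigenvectorBasis i.1))
      (LinearMap.pi fun i => innerₛₗ ℝ (h'.eigenvectorBasis i.1))
  have hL : LinearMap.ker L ≠ ⊥ := by
    apply LinearMap.ker_ne_bot_of_finrank_lt
    rw [Module.finrank_prod, Module.finrank_fintype_fun_eq_card,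
      Module.finrank_fintype_fun_eq_card, finrank_euclideanSpace, Fintype.card_subtype_compl]
    have := Fintype.card_subtype_le (fun i => 0 < h.eigenvalues i)
    omega
  obtain ⟨x, hx, hx0⟩ := Submodule.exists_mem_ne_zero_of_ne_bot hL
  rw [LinearMap.mem_ker, Prod.ext_iff] at hx
  have hx1 : ∀ i, ¬ 0 < h.eigenvalues i → inner ℝ (h.eigenvectorBasis i) x = 0 :=
    fun i hi => congrFun hx.1 ⟨i, hi⟩
  have hx2 : ∀ i, 0 < h'.eigenvalues i → inner ℝ (h'.eigenvectorBasis i) x = 0 :=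
    fun i hi => congrFun hx.2 ⟨i, hi⟩
  have q1 : c * ‖x‖ ^ 2 ≤ inner ℝ x (Matrix.toEuclideanLin X x) := by
    rw [quad_eq X h, ← h.eigenvectorBasis.sum_sq_norm_inner_right, Finset.mul_sum]
    refine Finset.sum_le_sum fun i _ => ?_
    by_cases hi : 0 < h.eigenvalues i
    · rw [Real.norm_eq_abs, sq_abs]
      exact mul_le_mul_of_nonneg_right (hc i hi) (sq_nonneg _)
    · simp [hx1 i hi]
  have q2 : inner ℝ x (Matrix.toEuclideanLin (X + t • A) x) ≤ 0 := by
    rw [quad_eq _ h']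
    refine Finset.sum_nonpos fun i _ => ?_
    by_cases hi : 0 < h'.eigenvalues i
    · simp [hx2 i hi]
    · exact mul_nonpos_of_nonpos_of_nonneg (not_lt.1 hi) (sq_nonneg _)
  have q3 : inner ℝ x (Matrix.toEuclideanLin (X + t • A) x) =
      inner ℝ x (Matrix.toEuclideanLin X x) + t * inner ℝ x (T x) := by
    rw [map_add, map_smul, LinearMap.add_apply, LinearMap.smul_apply, inner_add_right,
      inner_smul_right]
    rfl
  have hxp : 0 < ‖x‖ ^ 2 := by positivity
  have q4 : |inner ℝ x (T x)| ≤ ‖T‖ * ‖x‖ ^ 2 := by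
    calc _ ≤ ‖x‖ * ‖T x‖ := abs_real_inner_le_norm _ _
      _ ≤ ‖x‖ * (‖T‖ * ‖x‖) := by gcongr; exact T.le_opNorm x
      _ = _ := by ring
  have q5 : |t * inner ℝ x (T x)| ≤ |t| * (‖T‖ * ‖x‖ ^ 2) := by
    rw [abs_mul]; gcongr
  rw [lt_div_iff₀ (by positivity)] at ht
  have q6 := neg_abs_le (t * inner ℝ x (T x))
  have := abs_nonneg t
  nlinarith [mul_lt_mul_of_pos_right ht hxp, mul_nonneg this hxp.le]

/-- Let `M`, `A` be symmetric with `ker M ⊆ ker A` and `corank (βA + M) ≥ corank M` for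
all `β`.  If `β_n → α` with `λ⁻(β_n A + M) ≥ 2` for all `n`, then
`corank (αA + M) ≥ k + 1` or `λ⁻(αA + M) ≥ 2` (where `k = corank M`); in particular, if
additionally `λ⁻(αA + M) ≤ 1` then `corank (αA + M) ≥ k + 1`. -/
theorem stmt_10 {V : Type*} [Fintype V] [DecidableEq V]
    (M A : Matrix V V ℝ) (hM : M.IsHermitian) (hA : A.IsHermitian)
    (hker : LinearMap.ker M.mulVecLin ≤ LinearMap.ker A.mulVecLin)
    (hcr : ∀ β : ℝ, corank M ≤ corank (β • A + M))
    (k : ℕ) (hk : k = corank M)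
    (α : ℝ) (β : ℕ → ℝ) (hβα : Filter.Tendsto β Filter.atTop (nhds α))
    (hneg : ∀ n : ℕ, 2 ≤ negEig (β n • A + M)) :
    (k + 1 ≤ corank (α • A + M) ∨ 2 ≤ negEig (α • A + M)) ∧
    (negEig (α • A + M) ≤ 1 → k + 1 ≤ corank (α • A + M)) := by
  have hX : ∀ b : ℝ, (b • A + M).IsHermitian := fun b =>
    (show (b • A).IsHermitian by
      unfold Matrix.IsHermitian
      rw [Matrix.conjTranspose_smul, hA.eq]; simp).add hM
  have main : k + 1 ≤ corank (α • A + M) ∨ 2 ≤ negEig (α • A + M) := by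
    by_contra! hcon
    obtain ⟨ε, hε, H⟩ := pos_semicont (α • A + M) A (hX α)
    obtain ⟨n, hn⟩ := (Metric.tendsto_nhds.1 hβα ε hε).exists
    have e : (α • A + M) + (β n - α) • A = β n • A + M := by
      rw [sub_smul]; abel
    have h' : ((α • A + M) + (β n - α) • A).IsHermitian := e ▸ hX (β n)
    have h1 := H (β n - α) (by simpa [Real.dist_eq] using hn) h'
    have h2 := count_eq _ h'
    have h3 := count_eq _ (hX α)
    have h4 := hneg n
    have h5 := hcr (β n)
    rw [← e] at h4 h5
    omega
  exact ⟨main, fun h => main.resolve_right (by omega)⟩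
end

section
/- The complete bipartite graph K_{4,4} is not linklessly embeddable; equivalently, any graph having K_{4,4} as a minor is not flat. -/
/-- An embedding of a graph `G` into `ℝ³`: an injective placement of the vertices,
together with, for each edge, an arc (a homeomorphic image of `[0,1]`) joining its two
endpoints, such that arcs of distinct edges meet only in common endpoints and no vertex
lies in the interior of an arc. -/
structure GraphEmbedding3 {V : Type*} (G : SimpleGraph V) where
  vert : V → EuclideanSpace ℝ (Fin 3)
  vertInj : Function.Injective vert
  arc : ∀ i j : V, G.Adj i j → Set (EuclideanSpace ℝ (Fin 3))
  arcSymm : ∀ (i j : V) (h : G.Adj i j), arc i j h = arc j i h.symm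
  arcParam : ∀ (i j : V) (h : G.Adj i j), ∃ f : ℝ → EuclideanSpace ℝ (Fin 3),
    ContinuousOn f (Set.Icc 0 1) ∧ Set.InjOn f (Set.Icc 0 1) ∧
    f '' Set.Icc 0 1 = arc i j h ∧ f 0 = vert i ∧ f 1 = vert j
  vertArc : ∀ (v i j : V) (h : G.Adj i j), vert v ∈ arc i j h → v = i ∨ v = j
  arcMeet : ∀ (i j : V) (h : G.Adj i j) (i' j' : V) (h' : G.Adj i' j'),
    s(i, j) ≠ s(i', j') →
      arc i j h ∩ arc i' j' h' ⊆ ({vert i, vert j} : Set _) ∩ {vert i', vert j'}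

/-- The image (body) of an embedded graph: all vertex points and all edge arcs. -/
def GraphEmbedding3.body {V : Type*} {G : SimpleGraph V} (F : GraphEmbedding3 G) :
    Set (EuclideanSpace ℝ (Fin 3)) :=
  Set.range F.vert ∪ ⋃ (i : V) (j : V) (h : G.Adj i j), F.arc i j h

/-- The image of a closed walk (in particular of a circuit): the union of the arcs of its
edges. -/
def GraphEmbedding3.cycleSet {V : Type*} {G : SimpleGraph V} (F : GraphEmbedding3 G)
    {v : V} (c : G.Walk v v) : Set (EuclideanSpace ℝ (Fin 3)) :=
  {x | ∃ (i j : V) (h : G.Adj i j), s(i, j) ∈ c.edges ∧ x ∈ F.arc i j h}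

/-- The embedding is flat: the image of every circuit bounds a disk that is disjoint from
the image of the remainder of the graph. -/
def GraphEmbedding3.IsFlat {V : Type*} {G : SimpleGraph V} (F : GraphEmbedding3 G) : Prop :=
  ∀ (v : V) (c : G.Walk v v), c.IsCycle →
    ∃ φ : EuclideanSpace ℝ (Fin 2) → EuclideanSpace ℝ (Fin 3),
      ContinuousOn φ (Metric.closedBall 0 1) ∧ Set.InjOn φ (Metric.closedBall 0 1) ∧
      φ '' Metric.sphere 0 1 = F.cycleSet c ∧
      (φ '' Metric.closedBall 0 1) ∩ (F.body \ F.cycleSet c) = ∅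

/-- A graph is flat (linklessly embeddable) if it admits a flat embedding in `ℝ³`. -/
def SimpleGraph.IsFlatGraph {V : Type*} (G : SimpleGraph V) : Prop :=
  ∃ F : GraphEmbedding3 G, F.IsFlat

/-- `H` is a minor of `G`: there are nonempty pairwise disjoint connected branch sets in
`G`, one for each vertex of `H`, joined by an edge of `G` whenever the corresponding
vertices are adjacent in `H`. -/
def SimpleGraph.IsMinorOf {α β : Type*} (H : SimpleGraph α) (G : SimpleGraph β) : Prop :=
  ∃ f : α → Set β, (∀ a, (f a).Nonempty) ∧ (∀ a, (G.induce (f a)).Connected) ∧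
    (Pairwise fun a b => Disjoint (f a) (f b)) ∧
    ∀ a b : α, H.Adj a b → ∃ x ∈ f a, ∃ y ∈ f b, G.Adj x y


namespace K44

abbrev Pt := Fin 3 → ℝ

/-- lexicographic comparison, with values in `ZMod 2` -/
noncomputable def lt (p q : Pt) : ZMod 2 :=
  open Classical in
  if p 0 < q 0 ∨ (p 0 = q 0 ∧ (p 1 < q 1 ∨ (p 1 = q 1 ∧ p 2 < q 2))) then 1 else 0

/-- coarse version of: `p` lies above the planar segment `cd` -/
noncomputable def ov (p c d : Pt) : ZMod 2 :=
  open Classical in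
  if c 1 + d 1 < p 1 + p 1 then lt p c + lt p d else 0

/-- coarse planar crossing number -/
noncomputable def cr (s t : Pt × Pt) : ZMod 2 :=
  (ov s.1 t.1 t.2 + ov s.2 t.1 t.2) + (ov t.1 s.1 s.2 + ov t.2 s.1 s.2) +
    ((lt s.1 t.1 + lt s.2 t.1) + (lt s.1 t.2 + lt s.2 t.2))

/-- coarse over-crossing number -/
noncomputable def bf (s t : Pt × Pt) : ZMod 2 :=
  open Classical in
  if t.1 2 + t.2 2 < s.1 2 + s.2 2 then cr s t else 0

theorem zz (x : ZMod 2) : x + x = 0 := CharTwo.add_self_eq_zero x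

theorem lt_add (p q : Pt) (h : p ≠ q) : lt p q + lt q p = 1 := by
  have : ¬ (p 0 = q 0 ∧ p 1 = q 1 ∧ p 2 = q 2) := by
    rintro ⟨h0, h1, h2⟩
    apply h
    funext i
    fin_cases i <;> assumption
  unfold lt
  rcases lt_trichotomy (p 0) (q 0) with h0 | h0 | h0 <;>
  rcases lt_trichotomy (p 1) (q 1) with h1 | h1 | h1 <;>
  rcases lt_trichotomy (p 2) (q 2) with h2 | h2 | h2 <;>
  simp_all [not_lt_of_gt, ne_of_gt, ne_of_lt]

theorem lt_of (p q : Pt) (h : p 0 < q 0) : lt p q = 1 := by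
  unfold lt; rw [if_pos (Or.inl h)]

theorem lt_of' (p q : Pt) (h : q 0 < p 0) : lt p q = 0 := by
  unfold lt; rw [if_neg]; rintro (h' | h') <;> linarith

theorem ov_symm (p c d : Pt) : ov p c d = ov p d c := by
  unfold ov; rw [add_comm (c 1), add_comm (lt p c)]

theorem cr_symm_right (s : Pt × Pt) (c d : Pt) : cr s (c, d) = cr s (d, c) := by
  unfold cr; simp only [ov_symm _ c d]; ring

theorem bf_symm_right (s : Pt × Pt) (c d : Pt) : bf s (c, d) = bf s (d, c) := by
  unfold bf; simp only [cr_symm_right s c d, add_comm (c 2)]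

theorem bf_diag (s : Pt × Pt) (c : Pt) : bf s (c, c) = 0 := by
  have h : ∀ p, ov p c c = 0 := by intro p; unfold ov; simp [zz]
  have : cr s (c, c) = 0 := by unfold cr; simp [h, zz]
  unfold bf; simp [this]

theorem dcoord {p q : Pt} {δ : ℝ} (h : dist p q < δ) (i : Fin 3) :
    p i < q i + δ ∧ q i < p i + δ := by
  have := (dist_le_pi_dist p q i).trans_lt h
  rw [Real.dist_eq, abs_lt] at this
  constructor <;> linarith [this.1, this.2]

theorem dfar {p q : Pt} {r : ℝ} (hr : 0 < r) (h : r ≤ dist p q) :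
    ∃ i, p i + r ≤ q i ∨ q i + r ≤ p i := by
  by_contra! hc
  refine absurd h (not_le.2 ((dist_pi_lt_iff hr).2 fun i => ?_))
  rw [Real.dist_eq, abs_lt]
  constructor <;> linarith [(hc i).1, (hc i).2]

theorem ne_far {a b c d : Pt} {δ : ℝ} (hδ : 0 < δ) (hab : dist a b < δ) (hcd : dist c d < δ)
    (h : 4 * δ ≤ dist a c) : a ≠ c ∧ a ≠ d ∧ b ≠ c ∧ b ≠ d := by
  refine ⟨?_, ?_, ?_, ?_⟩ <;> rintro rfl
  · rw [dist_self] at h; linarith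
  · rw [dist_comm] at h; linarith
  · linarith
  · have := dist_triangle a b c
    rw [dist_comm b c] at this
    linarith

theorem cr_comm {a b c d : Pt} (h : a ≠ c ∧ a ≠ d ∧ b ≠ c ∧ b ≠ d) :
    cr (a, b) (c, d) = cr (c, d) (a, b) := by
  have h1 := lt_add _ _ h.1
  have h2 := lt_add _ _ h.2.1
  have h3 := lt_add _ _ h.2.2.1
  have h4 := lt_add _ _ h.2.2.2
  have h5 : (4 : ZMod 2) = 0 := by decide
  have h6 : (2 : ZMod 2) = 0 := by decide
  unfold cr
  dsimp only
  linear_combination h1 + h2 + h3 + h4 + h5 - (lt c a + lt d a + lt c b + lt d b) * h6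

theorem cr_zero {a b c d : Pt} {δ : ℝ} (hδ : 0 < δ) (hab : dist a b < δ) (hcd : dist c d < δ)
    (hne : a ≠ c ∧ a ≠ d ∧ b ≠ c ∧ b ≠ d)
    (h : (a 0 + 4 * δ ≤ c 0 ∨ c 0 + 4 * δ ≤ a 0) ∨ (a 1 + 4 * δ ≤ c 1 ∨ c 1 + 4 * δ ≤ a 1)) :
    cr (a, b) (c, d) = 0 := by
  have a0 := dcoord hab 0
  have a1 := dcoord hab 1
  have c0 := dcoord hcd 0
  have c1 := dcoord hcd 1
  have h1 := lt_add _ _ hne.1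
  have h2 := lt_add _ _ hne.2.1
  have h3 := lt_add _ _ hne.2.2.1
  have h4 := lt_add _ _ hne.2.2.2
  have h5 : (4 : ZMod 2) = 0 := by decide
  have h6 : (2 : ZMod 2) = 0 := by decide
  rcases h with (h | h) | (h | h)
  · unfold cr ov
    dsimp only
    rw [lt_of a c (by linarith), lt_of a d (by linarith), lt_of b c (by linarith),
      lt_of b d (by linarith), lt_of' c a (by linarith), lt_of' c b (by linarith),
      lt_of' d a (by linarith), lt_of' d b (by linarith)]
    simp [zz]
  · unfold cr ov
    dsimp only
    rw [lt_of' a c (by linarith), lt_of' a d (by linarith), lt_of' b c (by linarith),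
      lt_of' b d (by linarith), lt_of c a (by linarith), lt_of c b (by linarith),
      lt_of d a (by linarith), lt_of d b (by linarith)]
    simp [zz]
  · unfold cr ov
    dsimp only
    rw [if_neg (by linarith), if_neg (by linarith), if_pos (by linarith), if_pos (by linarith)]
    linear_combination h1 + h2 + h3 + h4 + h5
  · unfold cr ov
    dsimp only
    rw [if_pos (by linarith), if_pos (by linarith), if_neg (by linarith), if_neg (by linarith)]
    linear_combination (lt a c + lt b c + lt a d + lt b d) * h6

theorem bf_anti {a b c d : Pt} {δ : ℝ} (hδ : 0 < δ) (hab : dist a b < δ) (hcd : dist c d < δ)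
    (h : 4 * δ ≤ dist a c) : bf (a, b) (c, d) + bf (c, d) (a, b) = cr (a, b) (c, d) := by
  have hne := ne_far hδ hab hcd h
  have a2 := dcoord hab 2
  have c2 := dcoord hcd 2
  obtain ⟨i, hi⟩ := dfar (by linarith) h
  unfold bf
  rw [← cr_comm hne]
  fin_cases i
  · rw [cr_zero hδ hab hcd hne (Or.inl hi)]; simp
  · rw [cr_zero hδ hab hcd hne (Or.inr hi)]; simp
  · dsimp at hi ⊢
    rcases hi with hi | hi
    · rw [if_neg (by linarith), if_pos (by linarith)]; simp
    · rw [if_pos (by linarith), if_neg (by linarith)]; simp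

noncomputable def gg (k l m a : Pt) : ZMod 2 :=
  open Classical in
  if k 2 < a 2 then ov a k l + ov a l m + ov a m k else 0

theorem gg_zero {k l m a : Pt} {δ : ℝ} (hδ : 0 < δ) (hkl : dist k l < δ) (hkm : dist k m < δ)
    (h : (a 0 + 4 * δ ≤ k 0 ∨ k 0 + 4 * δ ≤ a 0) ∨ (a 1 + 4 * δ ≤ k 1 ∨ k 1 + 4 * δ ≤ a 1)) :
    gg k l m a = 0 := by
  have l0 := dcoord hkl 0
  have l1 := dcoord hkl 1
  have m0 := dcoord hkm 0
  have m1 := dcoord hkm 1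
  have h6 : (2 : ZMod 2) = 0 := by decide
  have : ov a k l + ov a l m + ov a m k = 0 := by
    unfold ov
    rcases h with (h | h) | (h | h)
    · rw [lt_of a k (by linarith), lt_of a l (by linarith), lt_of a m (by linarith)]
      simp [zz]
    · rw [lt_of' a k (by linarith), lt_of' a l (by linarith), lt_of' a m (by linarith)]
      simp
    · rw [if_neg (by linarith), if_neg (by linarith), if_neg (by linarith)]
      simp
    · rw [if_pos (by linarith), if_pos (by linarith), if_pos (by linarith)]
      linear_combination (lt a k + lt a l + lt a m) * h6
  unfold gg
  simp [this]

theorem bf_tri {a b k l m : Pt} {δ : ℝ} (hδ : 0 < δ) (hab : dist a b < δ) (hkl : dist k l < δ)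
    (hlm : dist l m < δ) (hkm : dist k m < δ) (h : 10 * δ ≤ dist a k) :
    bf (a, b) (k, l) + bf (a, b) (l, m) + bf (a, b) (m, k) = gg k l m a + gg k l m b := by
  have hmk : dist m k < δ := by rwa [dist_comm]
  have hal : 9 * δ ≤ dist a l := by
    have := dist_triangle_right a k l; linarith
  have ham : 9 * δ ≤ dist a m := by
    have := dist_triangle_right a k m; linarith
  have n1 := ne_far hδ hab hkl (by linarith)
  have n2 := ne_far hδ hab hlm (by linarith)
  have n3 := ne_far hδ hab hmk (by linarith)
  obtain ⟨i, hi⟩ := dfar (by linarith) h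
  have ab := dcoord hab i
  have kl := dcoord hkl i
  have km := dcoord hkm i
  have h6 : (2 : ZMod 2) = 0 := by decide
  have key : ((a 0 + 10 * δ ≤ k 0 ∨ k 0 + 10 * δ ≤ a 0) ∨ (a 1 + 10 * δ ≤ k 1 ∨ k 1 + 10 * δ ≤ a 1))
      → bf (a, b) (k, l) + bf (a, b) (l, m) + bf (a, b) (m, k) = gg k l m a + gg k l m b := by
    intro hh
    have ab0 := dcoord hab 0
    have kl0 := dcoord hkl 0
    have km0 := dcoord hkm 0
    have ab1 := dcoord hab 1
    have kl1 := dcoord hkl 1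
    have km1 := dcoord hkm 1
    have e : ∀ x y : Pt, (x = a ∨ x = b) → (y = k ∨ y = l ∨ y = m) →
        ((x 0 + 4 * δ ≤ y 0 ∨ y 0 + 4 * δ ≤ x 0) ∨ (x 1 + 4 * δ ≤ y 1 ∨ y 1 + 4 * δ ≤ x 1)) := by
      rintro x y (rfl | rfl) (rfl | rfl | rfl) <;> rcases hh with (hh | hh) | (hh | hh)
      all_goals first
        | exact Or.inl (Or.inl (by linarith))
        | exact Or.inl (Or.inr (by linarith))
        | exact Or.inr (Or.inl (by linarith))
        | exact Or.inr (Or.inr (by linarith))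
    unfold bf
    rw [cr_zero hδ hab hkl n1 (e _ _ (by simp) (by simp)),
      cr_zero hδ hab hlm n2 (e _ _ (by simp) (by simp)),
      cr_zero hδ hab hmk n3 (e _ _ (by simp) (by simp)),
      gg_zero hδ hkl hkm (e _ _ (by simp) (by simp)),
      gg_zero hδ hkl hkm (e _ _ (by simp) (by simp))]
    simp
  fin_cases i
  · exact key (Or.inl hi)
  · exact key (Or.inr hi)
  · dsimp at hi ab kl km
    unfold bf gg
    dsimp only
    rcases hi with hi | hi
    · rw [if_neg (by linarith), if_neg (by linarith), if_neg (by linarith), if_neg (by linarith),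
        if_neg (by linarith)]
      simp
    · rw [if_pos (by linarith), if_pos (by linarith), if_pos (by linarith), if_pos (by linarith),
        if_pos (by linarith)]
      unfold cr
      dsimp only
      linear_combination (ov k a b + ov l a b + ov m a b + lt a k + lt a l + lt a m +
        lt b k + lt b l + lt b m) * h6

end K44
namespace K44

/-- the multiset of the `N` sampled segments of a path -/
noncomputable def sg (N : ℕ) (p : ℝ → Pt) : Multiset (Pt × Pt) :=
  (Multiset.range N).map fun i : ℕ => (p ((i : ℝ) / N), p (((i + 1 : ℕ) : ℝ) / N))

/-- the chain `l` has boundary `a + b` -/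
def Tel (l : Multiset (Pt × Pt)) (a b : Pt) : Prop :=
  ∀ h : Pt → ZMod 2, (l.map fun s => h s.1 + h s.2).sum = h a + h b

noncomputable def lk (l m : Multiset (Pt × Pt)) : ZMod 2 :=
  (l.map fun s => (m.map fun t => bf s t).sum).sum

noncomputable def crs (l m : Multiset (Pt × Pt)) : ZMod 2 :=
  (l.map fun s => (m.map fun t => cr s t).sum).sum

noncomputable def ovs (a : Pt) (m : Multiset (Pt × Pt)) : ZMod 2 :=
  (m.map fun t => ov a t.1 t.2).sum

theorem sum_tel (N : ℕ) (h : ℕ → ZMod 2) :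
    ∑ i ∈ Finset.range N, (h i + h (i + 1)) = h 0 + h N := by
  induction N with
  | zero => simp [zz]
  | succ n ih =>
    rw [Finset.sum_range_succ, ih]
    linear_combination zz (h n)

theorem sg_sum (N : ℕ) (p : ℝ → Pt) (F : Pt × Pt → ZMod 2) :
    ((sg N p).map F).sum =
      ∑ i ∈ Finset.range N, F (p ((i : ℝ) / N), p (((i + 1 : ℕ) : ℝ) / N)) := by
  unfold sg
  rw [Multiset.map_map]
  rfl

theorem tel_sg {N : ℕ} (hN : 0 < N) (p : ℝ → Pt) : Tel (sg N p) (p 0) (p 1) := by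
  intro h
  rw [sg_sum]
  have := sum_tel N (fun i => h (p ((i : ℝ) / N)))
  have hN' : (N : ℝ) ≠ 0 := by positivity
  simpa [div_self hN'] using this

theorem lk_add_left (l l' m : Multiset (Pt × Pt)) : lk (l + l') m = lk l m + lk l' m := by
  simp [lk]

theorem lk_add_right (l m m' : Multiset (Pt × Pt)) : lk l (m + m') = lk l m + lk l m' := by
  simp [lk]

theorem lk_zero_left (m : Multiset (Pt × Pt)) : lk 0 m = 0 := by
  simp [lk]

theorem lk_zero_right (m : Multiset (Pt × Pt)) : lk m 0 = 0 := by
  simp [lk]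

theorem Tel.add {l m : Multiset (Pt × Pt)} {a b c : Pt} (hl : Tel l a b) (hm : Tel m b c) :
    Tel (l + m) a c := by
  intro h
  rw [Multiset.map_add, Multiset.sum_add, hl h, hm h]
  linear_combination zz (h b)

theorem Tel.symm {l : Multiset (Pt × Pt)} {a b : Pt} (hl : Tel l a b) : Tel l b a := by
  intro h
  rw [hl h, add_comm]

theorem crs_formula {l m : Multiset (Pt × Pt)} {a b c d : Pt} (hl : Tel l a b) (hm : Tel m c d) :
    crs l m = (ovs a m + ovs b m) + (ovs c l + ovs d l) +
      ((lt a c + lt b c) + (lt a d + lt b d)) := by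
  have e1 : (l.map fun s => (m.map fun t => ov s.1 t.1 t.2 + ov s.2 t.1 t.2).sum).sum
      = ovs a m + ovs b m := by
    have := hl (fun x => ovs x m)
    rw [← this]
    simp [ovs]
  have e2 : (l.map fun s => (m.map fun t => ov t.1 s.1 s.2 + ov t.2 s.1 s.2).sum).sum
      = ovs c l + ovs d l := by
    have : ∀ s : Pt × Pt, (m.map fun t => ov t.1 s.1 s.2 + ov t.2 s.1 s.2).sum =
      ov c s.1 s.2 + ov d s.1 s.2 := fun s => hm (fun x => ov x s.1 s.2)
    simp only [this]
    simp [ovs]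
  have e3 : (l.map fun s => (m.map fun t => (lt s.1 t.1 + lt s.2 t.1) +
      (lt s.1 t.2 + lt s.2 t.2)).sum).sum = (lt a c + lt b c) + (lt a d + lt b d) := by
    have : ∀ s : Pt × Pt, (m.map fun t => (lt s.1 t.1 + lt s.2 t.1) +
      (lt s.1 t.2 + lt s.2 t.2)).sum = (lt s.1 c + lt s.2 c) + (lt s.1 d + lt s.2 d) :=
      fun s => hm (fun x => lt s.1 x + lt s.2 x)
    simp only [this]
    rw [Multiset.sum_map_add, hl (fun x => lt x c), hl (fun x => lt x d)]
  rw [← e1, ← e2, ← e3]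
  simp only [crs, cr, Multiset.sum_map_add]

theorem lk_anti {l m : Multiset (Pt × Pt)} {δ : ℝ} (hδ : 0 < δ)
    (hl : ∀ s ∈ l, dist s.1 s.2 < δ) (hm : ∀ s ∈ m, dist s.1 s.2 < δ)
    (h : ∀ s ∈ l, ∀ t ∈ m, 4 * δ ≤ dist s.1 t.1) : lk l m + lk m l = crs l m := by
  have : lk m l = (l.map fun s => (m.map fun t => bf t s).sum).sum := by
    unfold lk
    rw [Multiset.sum_map_sum_map]
  rw [this]
  unfold lk crs
  rw [← Multiset.sum_map_add]
  congr 1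
  refine Multiset.map_congr rfl fun s hs => ?_
  rw [← Multiset.sum_map_add]
  congr 1
  refine Multiset.map_congr rfl fun t ht => ?_
  exact bf_anti hδ (hl s hs) (hm t ht) (h s hs t ht)

theorem grid_sum (N : ℕ) (β : Pt → Pt → ZMod 2) (hβ : ∀ x y, β x y = β y x) (H : ℕ → ℕ → Pt) :
    ∑ i ∈ Finset.range N, ∑ j ∈ Finset.range N,
      ((β (H i j) (H (i+1) j) + β (H (i+1) j) (H (i+1) (j+1)) + β (H (i+1) (j+1)) (H i j)) +
       (β (H i j) (H (i+1) (j+1)) + β (H (i+1) (j+1)) (H i (j+1)) + β (H i (j+1)) (H i j)))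
    = (∑ j ∈ Finset.range N, β (H 0 j) (H 0 (j+1)) + ∑ j ∈ Finset.range N, β (H N j) (H N (j+1))) +
      (∑ i ∈ Finset.range N, β (H i 0) (H (i+1) 0) + ∑ i ∈ Finset.range N, β (H i N) (H (i+1) N)) := by
  have e : ∀ i j, ((β (H i j) (H (i+1) j) + β (H (i+1) j) (H (i+1) (j+1)) + β (H (i+1) (j+1)) (H i j)) +
       (β (H i j) (H (i+1) (j+1)) + β (H (i+1) (j+1)) (H i (j+1)) + β (H i (j+1)) (H i j)))
      = (β (H i j) (H i (j+1)) + β (H (i+1) j) (H (i+1) (j+1))) +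
        (β (H i j) (H (i+1) j) + β (H i (j+1)) (H (i+1) (j+1))) := by
    intro i j
    rw [hβ (H (i+1) (j+1)) (H i j), hβ (H (i+1) (j+1)) (H i (j+1)), hβ (H i (j+1)) (H i j)]
    linear_combination zz (β (H i j) (H (i+1) (j+1)))
  simp only [e]
  have e1 : ∀ i, ∑ j ∈ Finset.range N, ((β (H i j) (H i (j+1)) + β (H (i+1) j) (H (i+1) (j+1))) +
        (β (H i j) (H (i+1) j) + β (H i (j+1)) (H (i+1) (j+1)))) =
      (∑ j ∈ Finset.range N, β (H i j) (H i (j+1)) +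
        ∑ j ∈ Finset.range N, β (H (i+1) j) (H (i+1) (j+1))) +
      (β (H i 0) (H (i+1) 0) + β (H i N) (H (i+1) N)) := by
    intro i
    rw [Finset.sum_add_distrib, Finset.sum_add_distrib (g := fun j => β (H (i+1) j) _),
      sum_tel N (fun j => β (H i j) (H (i+1) j))]
  simp only [e1]
  rw [Finset.sum_add_distrib, sum_tel N (fun i => ∑ j ∈ Finset.range N, β (H i j) (H i (j+1))),
    Finset.sum_add_distrib]

theorem lk_grid {N : ℕ} (hN : 0 < N) {l : Multiset (Pt × Pt)} {a : Pt} {δ : ℝ} (hδ : 0 < δ)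
    (hT : Tel l a a) (hl : ∀ s ∈ l, dist s.1 s.2 < δ) (H : ℝ → ℝ → Pt)
    (hH : ∀ s ∈ Set.Icc (0:ℝ) 1, ∀ t ∈ Set.Icc (0:ℝ) 1, ∀ s' ∈ Set.Icc (0:ℝ) 1,
      ∀ t' ∈ Set.Icc (0:ℝ) 1, |s - s'| ≤ 1 / N → |t - t'| ≤ 1 / N → dist (H s t) (H s' t') < δ)
    (hfar : ∀ x ∈ l, ∀ s ∈ Set.Icc (0:ℝ) 1, ∀ t ∈ Set.Icc (0:ℝ) 1, 10 * δ ≤ dist x.1 (H s t)) :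
    lk l (sg N (H 0)) + lk l (sg N (H 1)) +
      (lk l (sg N fun s => H s 0) + lk l (sg N fun s => H s 1)) = 0 := by
  set K : ℕ → ℕ → Pt := fun i j => H ((i : ℝ) / N) ((j : ℝ) / N) with hK
  have hN' : (0 : ℝ) < N := by exact_mod_cast hN
  have mem : ∀ i : ℕ, i ≤ N → (i : ℝ) / N ∈ Set.Icc (0:ℝ) 1 := by
    intro i hi
    refine ⟨by positivity, ?_⟩
    rw [div_le_one hN']
    exact_mod_cast hi
  have st : ∀ i : ℕ, |(i : ℝ) / N - ((i + 1 : ℕ) : ℝ) / N| ≤ 1 / N := by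
    intro i
    rw [← sub_div, abs_div, abs_of_pos hN']
    simp
  have st0 : ∀ i : ℕ, |(i : ℝ) / N - (i : ℝ) / N| ≤ 1 / N := by
    intro i
    simp
  have key : ∀ x ∈ l, ∑ i ∈ Finset.range N, ∑ j ∈ Finset.range N,
      ((bf x (K i j, K (i+1) j) + bf x (K (i+1) j, K (i+1) (j+1)) + bf x (K (i+1) (j+1), K i j)) +
       (bf x (K i j, K (i+1) (j+1)) + bf x (K (i+1) (j+1), K i (j+1)) + bf x (K i (j+1), K i j)))
      = (∑ i ∈ Finset.range N, ∑ j ∈ Finset.range N, (gg (K i j) (K (i+1) j) (K (i+1) (j+1)) x.1 +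
          gg (K i j) (K (i+1) (j+1)) (K i (j+1)) x.1)) +
        (∑ i ∈ Finset.range N, ∑ j ∈ Finset.range N, (gg (K i j) (K (i+1) j) (K (i+1) (j+1)) x.2 +
          gg (K i j) (K (i+1) (j+1)) (K i (j+1)) x.2)) := by
    intro x hx
    rw [← Finset.sum_add_distrib]
    refine Finset.sum_congr rfl fun i hi => ?_
    rw [← Finset.sum_add_distrib]
    refine Finset.sum_congr rfl fun j hj => ?_
    have hi := Finset.mem_range.1 hi
    have hj := Finset.mem_range.1 hj
    have mi := mem i hi.le
    have mi' := mem (i+1) hi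
    have mj := mem j hj.le
    have mj' := mem (j+1) hj
    have d1 : dist (K i j) (K (i+1) j) < δ := hH _ mi _ mj _ mi' _ mj (st i) (st0 j)
    have d2 : dist (K (i+1) j) (K (i+1) (j+1)) < δ :=
      hH _ mi' _ mj _ mi' _ mj' (st0 (i+1)) (st j)
    have d3 : dist (K i j) (K (i+1) (j+1)) < δ := hH _ mi _ mj _ mi' _ mj' (st i) (st j)
    have d4 : dist (K i (j+1)) (K (i+1) (j+1)) < δ :=
      hH _ mi _ mj' _ mi' _ mj' (st i) (st0 (j+1))
    have d5 : dist (K i j) (K i (j+1)) < δ := hH _ mi _ mj _ mi _ mj' (st0 i) (st j)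
    have f := hfar x hx _ mi _ mj
    have t1 := bf_tri hδ (hl x hx) d1 d2 d3 f
    have t2 := bf_tri hδ (hl x hx) d3 (by rwa [dist_comm]) d5 f
    rw [Prod.mk.eta] at t1 t2
    rw [t1, t2]
    ring
  have tot := hT (fun y => ∑ i ∈ Finset.range N, ∑ j ∈ Finset.range N,
    (gg (K i j) (K (i+1) j) (K (i+1) (j+1)) y + gg (K i j) (K (i+1) (j+1)) (K i (j+1)) y))
  rw [zz, ← Multiset.map_congr rfl key] at tot
  rw [← tot]
  simp only [fun x => grid_sum N (fun u v => bf x (u, v)) (fun u v => bf_symm_right x u v) K]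
  simp only [Multiset.sum_map_add]
  have c0 : ((0 : ℕ) : ℝ) / N = 0 := by simp
  have c1 : (N : ℝ) / N = 1 := div_self hN'.ne'
  simp only [lk, sg_sum, hK, c0, c1]

end K44
namespace K44

theorem path_edge {V : Type*} {G : SimpleGraph V} {u v : V} (p : G.Walk v u) (hp : p.IsPath)
    (h : s(u, v) ∈ p.edges) : p.edges = [s(u, v)] := by
  cases p with
  | nil => simp at h
  | @cons _ x _ h' q =>
    rw [SimpleGraph.Walk.cons_isPath_iff] at hp
    rw [SimpleGraph.Walk.edges_cons, List.mem_cons] at h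
    rcases h with h | h
    · have hx : x = u := by
        rw [Sym2.eq_iff] at h
        rcases h with h | h
        · exact absurd h.2 h'.ne
        · exact h.1.symm
      subst hx
      have := SimpleGraph.Walk.isPath_iff_nil.1 hp.1 |>.eq_nil
      subst this
      simp [Sym2.eq_swap]
    · exact absurd (SimpleGraph.Walk.snd_mem_support_of_mem_edges q h) hp.2

theorem bypass_sum {V : Type*} {G : SimpleGraph V} [DecidableEq V] {M : Type*} [AddCommGroup M]
    (hM : ∀ x : M, x + x = 0) (Z : AddSubgroup M) (g : Sym2 V → M) (A : Set V)
    (hc : ∀ (v : V) (c : G.Walk v v), c.IsCycle → (∀ x ∈ c.support, x ∈ A) →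
      (c.edges.map g).sum ∈ Z) {u v : V} (w : G.Walk u v) (hw : ∀ x ∈ w.support, x ∈ A) :
    (w.edges.map g).sum - (w.bypass.edges.map g).sum ∈ Z := by
  induction w with
  | nil => simp [SimpleGraph.Walk.bypass, Z.zero_mem]
  | @cons u x v h p ih =>
    have ih := ih (fun y hy => hw y (by simp [hy]))
    by_cases hs : u ∈ p.bypass.support
    · have e : (SimpleGraph.Walk.cons h p).bypass = p.bypass.dropUntil u hs := by
        simp [SimpleGraph.Walk.bypass, hs]
      rw [e]
      have e2 : (p.bypass.edges.map g).sum = ((p.bypass.takeUntil u hs).edges.map g).sum +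
          ((p.bypass.dropUntil u hs).edges.map g).sum := by
        conv_lhs => rw [← SimpleGraph.Walk.take_spec p.bypass hs]
        rw [SimpleGraph.Walk.edges_append, List.map_append, List.sum_append]
      have hpath : (p.bypass.takeUntil u hs).IsPath := p.bypass_isPath.takeUntil hs
      have e3 : g s(u, x) + ((p.bypass.takeUntil u hs).edges.map g).sum ∈ Z := by
        by_cases he : s(u, x) ∈ (p.bypass.takeUntil u hs).edges
        · rw [path_edge _ hpath he]
          simp [hM, Z.zero_mem]
        · have hcyc := (SimpleGraph.Walk.cons_isCycle_iff _ h).2 ⟨hpath, he⟩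
          have := hc _ _ hcyc (by
            intro y hy
            rw [SimpleGraph.Walk.support_cons, List.mem_cons] at hy
            rcases hy with rfl | hy
            · exact hw _ (by simp)
            · apply hw
              rw [SimpleGraph.Walk.support_cons]
              exact List.mem_cons_of_mem _ (p.support_bypass_subset_support
                (SimpleGraph.Walk.support_takeUntil_subset_support _ _ hy)))
          simpa using this
      have := Z.add_mem ih e3
      rw [e2] at this
      rw [SimpleGraph.Walk.edges_cons, List.map_cons, List.sum_cons]
      convert this using 1
      abel
    · have e : (SimpleGraph.Walk.cons h p).bypass = SimpleGraph.Walk.cons h p.bypass := by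
        simp [SimpleGraph.Walk.bypass, hs]
      rw [e]
      simpa using ih

theorem closed_sum {V : Type*} {G : SimpleGraph V} {M : Type*} [AddCommGroup M]
    (hM : ∀ x : M, x + x = 0) (Z : AddSubgroup M) (g : Sym2 V → M) (A : Set V)
    (hc : ∀ (v : V) (c : G.Walk v v), c.IsCycle → (∀ x ∈ c.support, x ∈ A) →
      (c.edges.map g).sum ∈ Z) {u : V} (w : G.Walk u u) (hw : ∀ x ∈ w.support, x ∈ A) :
    (w.edges.map g).sum ∈ Z := by
  classical
  have := bypass_sum hM Z g A hc w hw
  rw [(SimpleGraph.Walk.isPath_iff_nil.1 w.bypass_isPath).eq_nil] at this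
  simpa using this

/-- The van Kampen / Sachs computation for `K₄,₄` minus an edge. -/
theorem sachs (B : Fin 4 → Fin 4 → Fin 4 → Fin 4 → ZMod 2) (OA OB : Fin 4 → Fin 4 → Fin 4 → ZMod 2)
    (LA LB LC LD : Fin 4 → Fin 4 → ZMod 2)
    (hLB : ∀ i j, i ≠ j → LB i j + LB j i = 1)
    (hB : ∀ i j k l, i ≠ k → j ≠ l → B i j k l + B k l i j =
      (OA i k l + OB j k l) + (OA k i j + OB l i j) + ((LA i k + LD j k) + (LC i l + LB j l)))
    (hC : ∀ i j i' j' k l k' l', i ≠ k → i ≠ k' → i' ≠ k → i' ≠ k' → j ≠ l → j ≠ l' → j' ≠ l →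
      j' ≠ l' →
      (B i j k l + B i j k l' + B i j k' l + B i j k' l') +
      (B i j' k l + B i j' k l' + B i j' k' l + B i j' k' l') +
      (B i' j k l + B i' j k l' + B i' j k' l + B i' j k' l') +
      (B i' j' k l + B i' j' k l' + B i' j' k' l + B i' j' k' l') = 0) : False := by
  have h2 : (1 : ZMod 2) = 0 := by
    linear_combination (norm := (ring_nf; reduce_mod_char))
      hC 0 2 1 3 2 0 3 1 (by decide) (by decide) (by decide) (by decide) (by decide) (by decide) (by decide) (by decide) +
      hC 0 1 1 3 2 0 3 2 (by decide) (by decide) (by decide) (by decide) (by decide) (by decide) (by decide) (by decide) +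
      hC 0 1 1 2 2 0 3 3 (by decide) (by decide) (by decide) (by decide) (by decide) (by decide) (by decide) (by decide) +
      hC 0 2 2 3 1 0 3 1 (by decide) (by decide) (by decide) (by decide) (by decide) (by decide) (by decide) (by decide) +
      hC 0 1 2 3 1 0 3 2 (by decide) (by decide) (by decide) (by decide) (by decide) (by decide) (by decide) (by decide) +
      hC 0 1 2 2 1 0 3 3 (by decide) (by decide) (by decide) (by decide) (by decide) (by decide) (by decide) (by decide) +
      hC 0 2 3 3 1 0 2 1 (by decide) (by decide) (by decide) (by decide) (by decide) (by decide) (by decide) (by decide) +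
      hC 0 1 3 3 1 0 2 2 (by decide) (by decide) (by decide) (by decide) (by decide) (by decide) (by decide) (by decide) +
      hC 0 1 3 2 1 0 2 3 (by decide) (by decide) (by decide) (by decide) (by decide) (by decide) (by decide) (by decide) +
      hB 1 1 2 2 (by decide) (by decide) +
      hB 1 1 2 3 (by decide) (by decide) +
      hB 1 2 2 1 (by decide) (by decide) +
      hB 1 2 2 3 (by decide) (by decide) +
      hB 1 3 2 1 (by decide) (by decide) +
      hB 1 3 2 2 (by decide) (by decide) +
      hB 1 1 3 2 (by decide) (by decide) +
      hB 1 1 3 3 (by decide) (by decide) +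
      hB 1 2 3 1 (by decide) (by decide) +
      hB 1 2 3 3 (by decide) (by decide) +
      hB 1 3 3 1 (by decide) (by decide) +
      hB 1 3 3 2 (by decide) (by decide) +
      hB 2 1 3 2 (by decide) (by decide) +
      hB 2 1 3 3 (by decide) (by decide) +
      hB 2 2 3 1 (by decide) (by decide) +
      hB 2 2 3 3 (by decide) (by decide) +
      hB 2 3 3 1 (by decide) (by decide) +
      hB 2 3 3 2 (by decide) (by decide) +
      hLB 1 2 (by decide) +
      hLB 1 3 (by decide) +
      hLB 2 3 (by decide)
  exact one_ne_zero h2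
end K44
namespace K44
open Filter Topology

abbrev E3 := EuclideanSpace ℝ (Fin 3)

/-- sampled chain of a list of edges -/
noncomputable def wseg {V : Type*} (P : Sym2 V → ℝ → Pt) (N : ℕ) (L : List (Sym2 V)) :
    Multiset (Pt × Pt) := (L.map fun e => sg N (P e)).sum

theorem wseg_append {V : Type*} (P : Sym2 V → ℝ → Pt) (N : ℕ) (L L' : List (Sym2 V)) :
    wseg P N (L ++ L') = wseg P N L + wseg P N L' := by
  simp [wseg]

theorem wseg_reverse {V : Type*} (P : Sym2 V → ℝ → Pt) (N : ℕ) (L : List (Sym2 V)) :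
    wseg P N L.reverse = wseg P N L := by
  simp [wseg, List.sum_reverse]

theorem lk_wseg_right {V : Type*} (P : Sym2 V → ℝ → Pt) (N : ℕ) (L : List (Sym2 V))
    (l : Multiset (Pt × Pt)) :
    lk l (wseg P N L) = (L.map fun e => lk l (sg N (P e))).sum := by
  induction L with
  | nil => simp [wseg, lk_zero_right]
  | cons e L ih =>
    have : wseg P N (e :: L) = sg N (P e) + wseg P N L := by simp [wseg]
    rw [this, lk_add_right, ih]; simp

theorem mem_wseg {V : Type*} {P : Sym2 V → ℝ → Pt} {N : ℕ} {L : List (Sym2 V)} {s : Pt × Pt}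
    (h : s ∈ wseg P N L) : ∃ e ∈ L, s ∈ sg N (P e) := by
  induction L with
  | nil => simp [wseg] at h
  | cons e L ih =>
    have : wseg P N (e :: L) = sg N (P e) + wseg P N L := by simp [wseg]
    rw [this, Multiset.mem_add] at h
    rcases h with h | h
    · exact ⟨e, by simp, h⟩
    · obtain ⟨e', he', hs⟩ := ih h
      exact ⟨e', by simp [he'], hs⟩

theorem mem_icc {N i : ℕ} (hi : i ≤ N) : (i : ℝ) / N ∈ Set.Icc (0:ℝ) 1 := by
  refine ⟨by positivity, ?_⟩
  apply div_le_one_of_le₀ _ (by positivity)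
  exact_mod_cast hi

theorem mem_sg {N : ℕ} {p : ℝ → Pt} {s : Pt × Pt} (h : s ∈ sg N p) :
    ∃ t ∈ Set.Icc (0:ℝ) 1, s.1 = p t := by
  unfold sg at h
  rw [Multiset.mem_map] at h
  obtain ⟨i, hi, rfl⟩ := h
  exact ⟨_, mem_icc (Multiset.mem_range.1 hi).le, rfl⟩

theorem sg_congr {N : ℕ} {p q : ℝ → Pt} (h : ∀ t ∈ Set.Icc (0:ℝ) 1, p t = q t) :
    sg N p = sg N q := by
  unfold sg
  refine Multiset.map_congr rfl fun i hi => ?_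
  have hi := Multiset.mem_range.1 hi
  rw [h _ (mem_icc hi.le), h _ (mem_icc (i := i + 1) hi)]

theorem lk_const (N : ℕ) (l : Multiset (Pt × Pt)) (x : Pt) : lk l (sg N fun _ => x) = 0 := by
  unfold lk
  simp [sg_sum, bf_diag]

theorem ev_inv {η : ℝ} (hη : 0 < η) : ∀ᶠ N : ℕ in atTop, 0 < N ∧ 1 / (N : ℝ) < η := by
  have h := (tendsto_one_div_atTop_nhds_zero_nat (𝕜 := ℝ)).eventually (gt_mem_nhds hη)
  filter_upwards [h, eventually_gt_atTop 0] with N h1 h2 using ⟨h2, h1⟩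

theorem small_sg {p : ℝ → Pt} (hp : ContinuousOn p (Set.Icc 0 1)) {δ : ℝ} (hδ : 0 < δ) :
    ∀ᶠ N : ℕ in atTop, ∀ s ∈ sg N p, dist s.1 s.2 < δ := by
  have hu := isCompact_Icc.uniformContinuousOn_of_continuous hp
  obtain ⟨η, hη, h⟩ := Metric.uniformContinuousOn_iff.1 hu δ hδ
  filter_upwards [ev_inv hη] with N hN s hs
  unfold sg at hs
  rw [Multiset.mem_map] at hs
  obtain ⟨i, hi, rfl⟩ := hs
  have hi := Multiset.mem_range.1 hi
  refine h _ (mem_icc hi.le) _ (mem_icc (i := i + 1) hi) ?_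
  have hN' : (0 : ℝ) < N := by exact_mod_cast hN.1
  rw [Real.dist_eq, ← sub_div, abs_div, abs_of_pos hN']
  simpa using hN.2

theorem small_grid {H : ℝ → ℝ → Pt}
    (hH : ContinuousOn (fun x : ℝ × ℝ => H x.1 x.2) (Set.Icc 0 1 ×ˢ Set.Icc 0 1))
    {δ : ℝ} (hδ : 0 < δ) :
    ∀ᶠ N : ℕ in atTop, ∀ s ∈ Set.Icc (0:ℝ) 1, ∀ t ∈ Set.Icc (0:ℝ) 1, ∀ s' ∈ Set.Icc (0:ℝ) 1,
      ∀ t' ∈ Set.Icc (0:ℝ) 1, |s - s'| ≤ 1 / N → |t - t'| ≤ 1 / N →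
        dist (H s t) (H s' t') < δ := by
  have hu := (isCompact_Icc.prod isCompact_Icc).uniformContinuousOn_of_continuous hH
  obtain ⟨η, hη, h⟩ := Metric.uniformContinuousOn_iff.1 hu δ hδ
  filter_upwards [ev_inv hη] with N hN s hs t ht s' hs' t' ht' h1 h2
  refine h (s, t) ⟨hs, ht⟩ (s', t') ⟨hs', ht'⟩ ?_
  rw [Prod.dist_eq, max_lt_iff]
  exact ⟨h1.trans_lt hN.2, h2.trans_lt hN.2⟩

theorem sep {K L : Set Pt} (hK : IsCompact K) (hL : IsCompact L) (h : Disjoint K L) :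
    ∃ δ : ℝ, 0 < δ ∧ ∀ x ∈ K, ∀ y ∈ L, 10 * δ ≤ dist x y := by
  obtain ⟨r, hr, hd⟩ := Metric.exists_pos_forall_lt_edist hK hL.isClosed h
  refine ⟨(r : ℝ) / 10, by positivity, fun x hx y hy => ?_⟩
  have := hd x hx y hy
  rw [edist_nndist, ENNReal.coe_lt_coe] at this
  have : (r : ℝ) < dist x y := by rw [← coe_nndist]; exact_mod_cast this
  linarith

/-- data of parametrized edges -/
def IsPar {V : Type*} {G : SimpleGraph V} (F : GraphEmbedding3 G) (p : Sym2 V → ℝ → E3) : Prop :=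
  ∀ u v (h : G.Adj u v), ContinuousOn (p s(u, v)) (Set.Icc 0 1) ∧
    (∀ t ∈ Set.Icc (0:ℝ) 1, p s(u, v) t ∈ F.arc u v h) ∧
    ((p s(u, v) 0 = F.vert u ∧ p s(u, v) 1 = F.vert v) ∨
     (p s(u, v) 0 = F.vert v ∧ p s(u, v) 1 = F.vert u))

theorem exists_par {V : Type*} {G : SimpleGraph V} (F : GraphEmbedding3 G) :
    ∃ p, IsPar F p := by
  have : ∀ e : Sym2 V, ∃ f : ℝ → E3, ∀ u v (h : G.Adj u v), e = s(u, v) →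
      ContinuousOn f (Set.Icc 0 1) ∧
      (∀ t ∈ Set.Icc (0:ℝ) 1, f t ∈ F.arc u v h) ∧
      ((f 0 = F.vert u ∧ f 1 = F.vert v) ∨ (f 0 = F.vert v ∧ f 1 = F.vert u)) := by
    intro e
    induction e using Sym2.ind with
    | _ x y =>
      by_cases hxy : G.Adj x y
      · obtain ⟨f, hf, -, him, h0, h1⟩ := F.arcParam x y hxy
        refine ⟨f, fun u v h huv => ⟨hf, ?_⟩⟩
        have hm : ∀ t ∈ Set.Icc (0:ℝ) 1, f t ∈ F.arc x y hxy := by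
          intro t ht; rw [← him]; exact ⟨t, ht, rfl⟩
        rw [Sym2.eq_iff] at huv
        rcases huv with ⟨rfl, rfl⟩ | ⟨rfl, rfl⟩
        · exact ⟨hm, Or.inl ⟨h0, h1⟩⟩
        · refine ⟨?_, Or.inr ⟨h0, h1⟩⟩
          rw [F.arcSymm]; exact hm
      · refine ⟨fun _ => 0, fun u v h huv => absurd ?_ hxy⟩
        have : s(x, y) ∈ G.edgeSet := by rw [huv]; exact h
        exact this
  choose p hp using this
  exact ⟨p, fun u v h => hp _ u v h rfl⟩

/-- coordinates of sampled edges -/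
noncomputable def co {V : Type*} (p : Sym2 V → ℝ → E3) (e : Sym2 V) (t : ℝ) : Pt :=
  WithLp.ofLp (p e t)

theorem cont_ofLp : Continuous (fun x : E3 => (WithLp.ofLp x : Pt)) :=
  PiLp.continuous_ofLp 2 _

theorem arcs_disjoint {V : Type*} {G : SimpleGraph V} (F : GraphEmbedding3 G) {u v u' v' : V}
    (h : G.Adj u v) (h' : G.Adj u' v') (h1 : u ≠ u') (h2 : u ≠ v') (h3 : v ≠ u') (h4 : v ≠ v')
    {x : E3} (hx : x ∈ F.arc u v h) (hx' : x ∈ F.arc u' v' h') : False := by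
  have hne : s(u, v) ≠ s(u', v') := by
    rw [Ne, Sym2.eq_iff]; tauto
  obtain ⟨a, b⟩ := F.arcMeet u v h u' v' h' hne ⟨hx, hx'⟩
  simp only [Set.mem_insert_iff, Set.mem_singleton_iff] at a b
  rcases a with a | a <;> rcases b with b | b <;> rw [a] at b
  · exact h1 (F.vertInj b)
  · exact h2 (F.vertInj b)
  · exact h3 (F.vertInj b)
  · exact h4 (F.vertInj b)

theorem walk_sum {V : Type*} {G : SimpleGraph V} (g : Sym2 V → ZMod 2) (R : V → ZMod 2) {a b : V}
    (w : G.Walk a b) (h : ∀ u v, s(u, v) ∈ w.edges → g s(u, v) = R u + R v) :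
    (w.edges.map g).sum = R a + R b := by
  induction w with
  | nil => simp [zz]
  | @cons a x b hadj q ih =>
    have ih := ih (fun u v huv => h u v (by simp [huv]))
    simp only [SimpleGraph.Walk.edges_cons, List.map_cons, List.sum_cons]
    rw [ih, h a x (by simp)]
    linear_combination zz (R x)

theorem tel_walk {V : Type*} {G : SimpleGraph V} {F : GraphEmbedding3 G} {p : Sym2 V → ℝ → E3}
    (hp : IsPar F p) {N : ℕ} (hN : 0 < N) {a b : V} (w : G.Walk a b) :
    Tel (wseg (co p) N w.edges) (WithLp.ofLp (F.vert a)) (WithLp.ofLp (F.vert b)) := by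
  induction w with
  | nil => intro h; simp [wseg, zz]
  | @cons a x b hadj q ih =>
    have e : wseg (co p) N (SimpleGraph.Walk.cons hadj q).edges =
        sg N (co p s(a, x)) + wseg (co p) N q.edges := by simp [wseg]
    rw [e]
    refine Tel.add ?_ ih
    have t := tel_sg hN (co p s(a, x))
    unfold co at t
    rcases (hp a x hadj).2.2 with ⟨h0, h1⟩ | ⟨h0, h1⟩ <;> rw [h0, h1] at t
    · exact t
    · exact t.symm

def KS {V : Type*} (P : Sym2 V → ℝ → Pt) (L : List (Sym2 V)) : Set Pt :=
  ⋃ e ∈ {e | e ∈ L}, P e '' Set.Icc 0 1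

theorem KS_compact {V : Type*} {G : SimpleGraph V} {F : GraphEmbedding3 G} {p : Sym2 V → ℝ → E3}
    (hp : IsPar F p) {a b : V} (w : G.Walk a b) : IsCompact (KS (co p) w.edges) := by
  refine (List.finite_toSet w.edges).isCompact_biUnion fun e he => ?_
  induction e using Sym2.ind with
  | _ x y =>
    have hadj : G.Adj x y := w.adj_of_mem_edges he
    exact isCompact_Icc.image_of_continuousOn (cont_ofLp.comp_continuousOn (hp x y hadj).1)

theorem mem_KS {V : Type*} {G : SimpleGraph V} {F : GraphEmbedding3 G} {p : Sym2 V → ℝ → E3}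
    (hp : IsPar F p) {a b : V} (w : G.Walk a b) {x : Pt} (hx : x ∈ KS (co p) w.edges) :
    ∃ (u v : V) (h : G.Adj u v), s(u, v) ∈ w.edges ∧ WithLp.toLp 2 x ∈ F.arc u v h := by
  unfold KS at hx
  simp only [Set.mem_iUnion] at hx
  obtain ⟨e, he, t, ht, rfl⟩ := hx
  induction e using Sym2.ind with
  | _ x y =>
    have hadj : G.Adj x y := w.adj_of_mem_edges he
    exact ⟨x, y, hadj, he, (hp x y hadj).2.1 t ht⟩

theorem mem_KS_of {V : Type*} {P : Sym2 V → ℝ → Pt} {L : List (Sym2 V)} {N : ℕ} {s : Pt × Pt}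
    (hs : s ∈ wseg P N L) : s.1 ∈ KS P L := by
  obtain ⟨e, he, h⟩ := mem_wseg hs
  obtain ⟨t, ht, h⟩ := mem_sg h
  exact Set.mem_biUnion (x := e) he ⟨t, ht, h.symm⟩

theorem small_wseg {V : Type*} {G : SimpleGraph V} {F : GraphEmbedding3 G} {p : Sym2 V → ℝ → E3}
    (hp : IsPar F p) {a b : V} (w : G.Walk a b) {δ : ℝ} (hδ : 0 < δ) :
    ∀ᶠ N : ℕ in atTop, ∀ s ∈ wseg (co p) N w.edges, dist s.1 s.2 < δ := by
  have : ∀ᶠ N : ℕ in atTop, ∀ e ∈ {e | e ∈ w.edges}, ∀ s ∈ sg N (co p e), dist s.1 s.2 < δ := by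
    rw [eventually_all_finite (List.finite_toSet w.edges)]
    intro e he
    induction e using Sym2.ind with
    | _ x y =>
      have hadj : G.Adj x y := w.adj_of_mem_edges he
      exact small_sg (cont_ofLp.comp_continuousOn (hp x y hadj).1) hδ
  filter_upwards [this] with N hN s hs
  obtain ⟨e, he, h⟩ := mem_wseg hs
  exact hN e he s h

theorem walks_disjoint {V : Type*} {G : SimpleGraph V} (F : GraphEmbedding3 G)
    {a b c d : V} (w : G.Walk a b) (w' : G.Walk c d) (hd : ∀ x ∈ w.support, x ∉ w'.support)
    {u v u' v' : V} (h : G.Adj u v) (h' : G.Adj u' v') (he : s(u, v) ∈ w.edges)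
    (he' : s(u', v') ∈ w'.edges)
    {x : E3} (hx : x ∈ F.arc u v h) (hx' : x ∈ F.arc u' v' h') : False := by
  have hu := w.fst_mem_support_of_mem_edges he
  have hv := w.snd_mem_support_of_mem_edges he
  have hu' := w'.fst_mem_support_of_mem_edges he'
  have hv' := w'.snd_mem_support_of_mem_edges he'
  refine arcs_disjoint F h h' ?_ ?_ ?_ ?_ hx hx'
  · rintro rfl; exact hd _ hu hu'
  · rintro rfl; exact hd _ hu hv'
  · rintro rfl; exact hd _ hv hu'
  · rintro rfl; exact hd _ hv hv'

theorem walk_anti {V : Type*} {G : SimpleGraph V} {F : GraphEmbedding3 G} {p : Sym2 V → ℝ → E3}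
    (hp : IsPar F p) {a b c d : V} (w : G.Walk a b) (w' : G.Walk c d)
    (hd : ∀ x ∈ w.support, x ∉ w'.support) :
    ∀ᶠ N : ℕ in atTop, lk (wseg (co p) N w.edges) (wseg (co p) N w'.edges) +
      lk (wseg (co p) N w'.edges) (wseg (co p) N w.edges) =
      crs (wseg (co p) N w.edges) (wseg (co p) N w'.edges) := by
  have hdis : Disjoint (KS (co p) w.edges) (KS (co p) w'.edges) := by
    rw [Set.disjoint_left]
    intro x hx hx'
    obtain ⟨u, v, h, he, hm⟩ := mem_KS hp w hx
    obtain ⟨u', v', h', he', hm'⟩ := mem_KS hp w' hx'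
    exact walks_disjoint F w w' hd h h' he he' hm hm'
  obtain ⟨δ, hδ, hfar⟩ := sep (KS_compact hp w) (KS_compact hp w') hdis
  filter_upwards [small_wseg hp w hδ, small_wseg hp w' hδ] with N h1 h2
  refine lk_anti hδ h1 h2 fun s hs t ht => ?_
  have := hfar _ (mem_KS_of hs) _ (mem_KS_of ht)
  linarith

theorem cycle_lk {V : Type*} {G : SimpleGraph V} {F : GraphEmbedding3 G} {p : Sym2 V → ℝ → E3}
    (hp : IsPar F p) (hF : F.IsFlat) {a c : V} (w : G.Walk a a) (w' : G.Walk c c)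
    (hc : w'.IsCycle) (hd : ∀ x ∈ w.support, x ∉ w'.support) :
    ∀ᶠ N : ℕ in atTop, lk (wseg (co p) N w.edges) (wseg (co p) N w'.edges) = 0 := by
  obtain ⟨φ, hφ, hinj, hsph, hdisj⟩ := hF c w' hc
  set D : Set (EuclideanSpace ℝ (Fin 2)) := Metric.closedBall 0 1 with hD
  have hDc : IsCompact D := isCompact_closedBall 0 1
  set Φ : EuclideanSpace ℝ (Fin 2) → Pt := fun z => WithLp.ofLp (φ z) with hΦ
  have hΦc : ContinuousOn Φ D := cont_ofLp.comp_continuousOn hφ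
  set ψ : E3 → EuclideanSpace ℝ (Fin 2) := Function.invFunOn φ D with hψ
  have hcyc : ∀ u v (h : G.Adj u v), s(u, v) ∈ w'.edges → ∀ x ∈ F.arc u v h, x ∈ φ '' D := by
    intro u v h he x hx
    have : x ∈ F.cycleSet w' := ⟨u, v, h, he, hx⟩
    rw [← hsph] at this
    exact Set.image_mono Metric.sphere_subset_closedBall this
  have hψm : ∀ x ∈ φ '' D, ψ x ∈ D := fun x hx => Function.invFunOn_mem hx
  have hψe : ∀ x ∈ φ '' D, φ (ψ x) = x := fun x hx => Function.invFunOn_eq hx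
  have hψc : ContinuousOn ψ (φ '' D) := by
    rw [continuousOn_iff_isClosed]
    intro t ht
    refine ⟨φ '' (D ∩ t), ((hDc.inter_right ht).image_of_continuousOn
      (hφ.mono Set.inter_subset_left)).isClosed, ?_⟩
    ext x
    constructor
    · rintro ⟨h1, h2⟩
      exact ⟨⟨ψ x, ⟨hψm x h2, h1⟩, hψe x h2⟩, h2⟩
    · rintro ⟨⟨z, ⟨hz, hzt⟩, rfl⟩, h2⟩
      refine ⟨?_, h2⟩
      have : ψ (φ z) = z := hinj (hψm _ h2) hz (hψe _ h2)
      rw [Set.mem_preimage, this]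
      exact hzt
  have hdis : Disjoint (KS (co p) w.edges) (Φ '' D) := by
    rw [Set.disjoint_left]
    rintro x hx ⟨z, hz, rfl⟩
    obtain ⟨u, v, h, he, hm⟩ := mem_KS hp w hx
    have hm : φ z ∈ F.arc u v h := hm
    have : φ z ∈ (φ '' D) ∩ (F.body \ F.cycleSet w') := by
      refine ⟨⟨z, hz, rfl⟩, Or.inr ?_, ?_⟩
      · simp only [Set.mem_iUnion]
        exact ⟨u, v, h, hm⟩
      · rintro ⟨u', v', h', he', hm'⟩
        exact walks_disjoint F w w' hd h h' he he' hm hm'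
    rw [hdisj] at this
    exact this
  obtain ⟨δ, hδ, hfar⟩ := sep (KS_compact hp w) (hDc.image_of_continuousOn hΦc) hdis
  have hsm : ∀ s ∈ Set.Icc (0:ℝ) 1, ∀ z ∈ D, s • z ∈ D := by
    intro s hs z hz
    rw [hD, mem_closedBall_zero_iff] at hz ⊢
    rw [norm_smul, Real.norm_of_nonneg hs.1]
    exact mul_le_one₀ hs.2 (norm_nonneg _) hz
  set H : Sym2 V → ℝ → ℝ → Pt := fun e s t => Φ (s • ψ (p e t)) with hH
  have hpm : ∀ e ∈ w'.edges, ∀ t ∈ Set.Icc (0:ℝ) 1, p e t ∈ φ '' D := by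
    intro e he t ht
    induction e using Sym2.ind with
    | _ x y =>
      have hadj : G.Adj x y := w'.adj_of_mem_edges he
      exact hcyc x y hadj he _ ((hp x y hadj).2.1 t ht)
  have hgrid : ∀ᶠ N : ℕ in atTop, ∀ e ∈ {e | e ∈ w'.edges},
      ∀ s ∈ Set.Icc (0:ℝ) 1, ∀ t ∈ Set.Icc (0:ℝ) 1, ∀ s' ∈ Set.Icc (0:ℝ) 1,
      ∀ t' ∈ Set.Icc (0:ℝ) 1, |s - s'| ≤ 1 / N → |t - t'| ≤ 1 / N →
        dist (H e s t) (H e s' t') < δ := by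
    rw [eventually_all_finite (List.finite_toSet w'.edges)]
    intro e he
    apply small_grid _ hδ
    have hpc : ContinuousOn (p e) (Set.Icc 0 1) := by
      induction e using Sym2.ind with
      | _ x y => exact (hp x y (w'.adj_of_mem_edges he)).1
    have h1 : ContinuousOn (fun t => ψ (p e t)) (Set.Icc 0 1) :=
      hψc.comp hpc (fun t ht => hpm e he t ht)
    have h2 : ContinuousOn (fun x : ℝ × ℝ => ψ (p e x.2)) (Set.Icc 0 1 ×ˢ Set.Icc 0 1) :=
      h1.comp continuousOn_snd (fun x hx => hx.2)
    refine hΦc.comp (continuousOn_fst.smul h2) ?_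
    intro x hx
    exact hsm _ hx.1 _ (hψm _ (hpm e he _ hx.2))
  filter_upwards [hgrid, small_wseg hp w hδ, eventually_gt_atTop 0] with N hN hw hN0
  rw [lk_wseg_right]
  set l := wseg (co p) N w.edges with hl
  have := walk_sum (fun e => lk l (sg N (co p e)))
    (fun x => lk l (sg N (fun s => Φ (s • ψ (F.vert x))))) w' ?_
  · rw [this, zz]
  intro u v he
  have hadj : G.Adj u v := w'.adj_of_mem_edges he
  have g := lk_grid hN0 hδ (tel_walk hp hN0 w) hw (H s(u, v)) (hN _ he) (by
    intro x hx s hs t ht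
    exact hfar _ (mem_KS_of hx) _ ⟨_, hsm _ hs _ (hψm _ (hpm _ he t ht)), rfl⟩)
  have e0 : lk l (sg N (H s(u, v) 0)) = 0 := by
    have : H s(u, v) 0 = fun _ => Φ 0 := by funext t; simp [hH]
    rw [this, lk_const]
  have e1 : sg N (H s(u, v) 1) = sg N (co p s(u, v)) := by
    apply sg_congr
    intro t ht
    simp only [hH, hΦ, one_smul, co]
    rw [hψe _ (hpm _ he t ht)]
  rw [← hl, e0, e1] at g
  simp only [hH] at g
  rcases (hp u v hadj).2.2 with ⟨h0, h1⟩ | ⟨h0, h1⟩ <;> rw [h0, h1] at g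
  · rw [← CharTwo.add_eq_zero]; linear_combination g
  · rw [← CharTwo.add_eq_zero]; linear_combination g

theorem sum_fun {ι : Type*} (L : List ι) (g : ι → ℕ → ZMod 2) (N : ℕ) :
    (L.map g).sum N = (L.map fun e => g e N).sum := by
  induction L with
  | nil => simp
  | cons e L ih => simp [ih]

theorem closed_lk {V : Type*} {G : SimpleGraph V} {F : GraphEmbedding3 G} {p : Sym2 V → ℝ → E3}
    (hp : IsPar F p) (hF : F.IsFlat) {a c : V} (w : G.Walk a a) (w' : G.Walk c c)
    (hd : ∀ x ∈ w.support, x ∉ w'.support) :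
    ∀ᶠ N : ℕ in atTop, lk (wseg (co p) N w.edges) (wseg (co p) N w'.edges) = 0 := by
  let Z : AddSubgroup (ℕ → ZMod 2) :=
    { carrier := {h | ∀ᶠ N in atTop, h N = 0}
      zero_mem' := by simp
      add_mem' := by
        intro x y hx hy
        filter_upwards [hx, hy] with N h1 h2
        simp [h1, h2]
      neg_mem' := by
        intro x hx
        filter_upwards [hx] with N h1
        simp [h1] }
  have h := closed_sum (G := G) (M := ℕ → ZMod 2) (fun x => by funext N; exact zz _) Z
    (fun e N => lk (wseg (co p) N w.edges) (sg N (co p e))) {x | x ∉ w.support}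
    (by
      intro v c hc hA
      have := cycle_lk hp hF w c hc (fun x hx hx' => hA x hx' hx)
      change ∀ᶠ N in atTop, _
      filter_upwards [this] with N hN
      rw [sum_fun, ← hN, lk_wseg_right]) w' (fun x hx hx' => hd x hx' hx)
  have h : ∀ᶠ N in atTop, _ := h
  filter_upwards [h] with N hN
  rw [sum_fun] at hN
  rw [lk_wseg_right, hN]

theorem conn_walk {V : Type*} {G : SimpleGraph V} {A : Set V} (hA : (G.induce A).Connected)
    {x y : V} (hx : x ∈ A) (hy : y ∈ A) : ∃ w : G.Walk x y, ∀ z ∈ w.support, z ∈ A := by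
  obtain ⟨q⟩ := hA.preconnected ⟨x, hx⟩ ⟨y, hy⟩
  refine ⟨q.map (SimpleGraph.Embedding.induce A).toHom, ?_⟩
  intro z hz
  have h := SimpleGraph.Walk.support_map (SimpleGraph.Embedding.induce A).toHom q
  have hz := (congrArg (z ∈ ·) h).mp hz
  obtain ⟨t, -, rfl⟩ := List.mem_map.1 hz
  exact t.2

theorem core {V : Type*} (G : SimpleGraph V)
    (hm : (completeBipartiteGraph (Fin 4) (Fin 4)).IsMinorOf G) : ¬ G.IsFlatGraph := by
  rintro ⟨F, hF⟩
  obtain ⟨p, hp⟩ := exists_par F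
  obtain ⟨f, hne, hconn, hdis, hadj⟩ := hm
  choose r hr using hne
  have dis : ∀ {a b x}, a ≠ b → x ∈ f a → x ∉ f b := fun hab h1 h2 =>
    Set.disjoint_left.1 (hdis hab) h1 h2
  have hW : ∀ i j : Fin 4, ∃ w : G.Walk (r (Sum.inl i)) (r (Sum.inr j)),
      ∀ z ∈ w.support, z ∈ f (Sum.inl i) ∨ z ∈ f (Sum.inr j) := by
    intro i j
    obtain ⟨x, hx, y, hy, hxy⟩ := hadj (Sum.inl i) (Sum.inr j) (by simp)
    obtain ⟨w1, h1⟩ := conn_walk (hconn _) (hr (Sum.inl i)) hx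
    obtain ⟨w2, h2⟩ := conn_walk (hconn _) hy (hr (Sum.inr j))
    refine ⟨w1.append (SimpleGraph.Walk.cons hxy w2), ?_⟩
    intro z hz
    rw [SimpleGraph.Walk.mem_support_append_iff, SimpleGraph.Walk.support_cons,
      List.mem_cons] at hz
    rcases hz with hz | rfl | hz
    · exact Or.inl (h1 z hz)
    · exact Or.inl hx
    · exact Or.inr (h2 z hz)
  choose W hWs using hW
  let S : ℕ → Fin 4 → Fin 4 → Multiset (Pt × Pt) := fun N i j => wseg (co p) N (W i j).edges
  let vt : V → Pt := fun v => WithLp.ofLp (F.vert v)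
  have e1 : ∀ᶠ N : ℕ in atTop, ∀ i j k l : Fin 4, i ≠ k → j ≠ l →
      lk (S N i j) (S N k l) + lk (S N k l) (S N i j) = crs (S N i j) (S N k l) := by
    refine eventually_all.2 fun i => eventually_all.2 fun j => eventually_all.2 fun k =>
      eventually_all.2 fun l => eventually_all.2 fun hik => eventually_all.2 fun hjl => ?_
    refine walk_anti hp (W i j) (W k l) ?_
    intro x hx hx'
    rcases hWs _ _ _ hx with h | h <;> rcases hWs _ _ _ hx' with h' | h' <;>
      refine dis ?_ h h' <;> simp [hik, hjl]
  have e2 : ∀ᶠ N : ℕ in atTop, ∀ i j i' j' k l k' l' : Fin 4, i ≠ k → i ≠ k' → i' ≠ k → i' ≠ k' →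
      j ≠ l → j ≠ l' → j' ≠ l → j' ≠ l' →
      lk (S N i j + S N i' j + S N i' j' + S N i j')
        (S N k l + S N k' l + S N k' l' + S N k l') = 0 := by
    refine eventually_all.2 fun i => eventually_all.2 fun j => eventually_all.2 fun i' =>
      eventually_all.2 fun j' => eventually_all.2 fun k => eventually_all.2 fun l =>
      eventually_all.2 fun k' => eventually_all.2 fun l' => eventually_all.2 fun h1 =>
      eventually_all.2 fun h2 => eventually_all.2 fun h3 => eventually_all.2 fun h4 =>
      eventually_all.2 fun h5 => eventually_all.2 fun h6 => eventually_all.2 fun h7 =>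
      eventually_all.2 fun h8 => ?_
    let C : ∀ i j i' j' : Fin 4, G.Walk (r (Sum.inl i)) (r (Sum.inl i)) := fun i j i' j' =>
      (((W i j).append (W i' j).reverse).append (W i' j')).append (W i j').reverse
    have hC : ∀ i j i' j' N, wseg (co p) N (C i j i' j').edges =
        S N i j + S N i' j + S N i' j' + S N i j' := by
      intro i j i' j' N
      simp only [C, S, SimpleGraph.Walk.edges_append, SimpleGraph.Walk.edges_reverse,
        wseg_append, wseg_reverse]
    have hCs : ∀ i j i' j', ∀ x ∈ (C i j i' j').support, (x ∈ f (Sum.inl i) ∨ x ∈ f (Sum.inl i')) ∨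
        (x ∈ f (Sum.inr j) ∨ x ∈ f (Sum.inr j')) := by
      intro i j i' j' x hx
      simp only [C, SimpleGraph.Walk.mem_support_append_iff, SimpleGraph.Walk.support_reverse,
        List.mem_reverse] at hx
      rcases hx with ((hx | hx) | hx) | hx <;> have := hWs _ _ _ hx <;> tauto
    have := closed_lk hp hF (C i j i' j') (C k l k' l') (by
      intro x hx hx'
      rcases hCs _ _ _ _ _ hx with (h | h) | (h | h) <;>
        rcases hCs _ _ _ _ _ hx' with (h' | h') | (h' | h') <;>
        refine dis ?_ h h' <;> simp [*])
    filter_upwards [this] with N hN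
    rw [← hC, ← hC, hN]
  obtain ⟨N, hN1, hN2, hN0⟩ := (e1.and (e2.and (eventually_gt_atTop 0))).exists
  refine sachs (fun i j k l => lk (S N i j) (S N k l))
    (fun i k l => ovs (vt (r (Sum.inl i))) (S N k l))
    (fun j k l => ovs (vt (r (Sum.inr j))) (S N k l))
    (fun i k => lt (vt (r (Sum.inl i))) (vt (r (Sum.inl k))))
    (fun i k => lt (vt (r (Sum.inr i))) (vt (r (Sum.inr k))))
    (fun i k => lt (vt (r (Sum.inl i))) (vt (r (Sum.inr k))))
    (fun i k => lt (vt (r (Sum.inr i))) (vt (r (Sum.inl k)))) ?_ ?_ ?_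
  · intro i j hij
    apply lt_add
    intro h
    have h : r (Sum.inr i) = r (Sum.inr j) := F.vertInj (WithLp.ofLp_injective 2 h)
    have h1 := hr (Sum.inr i)
    rw [h] at h1
    exact dis (by simpa using hij) h1 (hr (Sum.inr j))
  · intro i j k l hik hjl
    rw [hN1 i j k l hik hjl]
    exact crs_formula (tel_walk hp hN0 (W i j)) (tel_walk hp hN0 (W k l))
  · intro i j i' j' k l k' l' h1 h2 h3 h4 h5 h6 h7 h8
    have := hN2 i j i' j' k l k' l' h1 h2 h3 h4 h5 h6 h7 h8
    simp only [lk_add_left, lk_add_right] at this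
    linear_combination this

theorem self_minor : (completeBipartiteGraph (Fin 4) (Fin 4)).IsMinorOf
    (completeBipartiteGraph (Fin 4) (Fin 4)) := by
  refine ⟨fun a => {a}, fun a => Set.singleton_nonempty a, fun a => ?_, ?_, ?_⟩
  · have : Nonempty ({a} : Set (Fin 4 ⊕ Fin 4)) := ⟨⟨a, rfl⟩⟩
    refine ⟨fun x y => ?_⟩
    rw [Subsingleton.elim x y]
  · intro a b hab
    simpa using hab
  · intro a b h
    exact ⟨a, rfl, b, rfl, h⟩

end K44
/-- `K₄,₄` is not linklessly embeddable; equivalently, any graph having `K₄,₄` as a minor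
is not flat. -/
theorem stmt_15 :
    ¬ (completeBipartiteGraph (Fin 4) (Fin 4)).IsFlatGraph ∧
    ∀ {W : Type*} (G' : SimpleGraph W),
      (completeBipartiteGraph (Fin 4) (Fin 4)).IsMinorOf G' → ¬ G'.IsFlatGraph := by
  exact ⟨K44.core _ K44.self_minor, fun G h => K44.core G h⟩
end
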